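/- Let H be a Hopf quasigroup and M a right H-Hopf module with action (m,h) ↦ m·h and coaction ρ, and let ⊳ be the induced action m ⊳ h := (m₍₀₎·Sm₍₁₎)·(m₍₂₎h). Then: (a) the induced action constructed (by the same formula) from the right H-Hopf module (M, ⊳, ρ) coincides with ⊳, i.e. (m₍₀₎ ⊳ Sm₍₁₎) ⊳ (m₍₂₎h) = m ⊳ h for all m ∈ M, h ∈ H; and (b) if the original action is associative, i.e. (m·g)·h = m·(gh) for all m ∈ M, g,h ∈ H, then m ⊳ h = m·h. -/

import Mathlib

open TensorProduct

noncomputable section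

/-- The componentwise product on `H ⊗[k] H` induced by a bilinear multiplication on `H`:
`(a ⊗ b) * (c ⊗ d) = a c ⊗ b d`. -/
def tmul2 (k : Type*) [Field k] (H : Type*) [AddCommGroup H] [Module k H]
    (mul : H →ₗ[k] H →ₗ[k] H) :
    H ⊗[k] H →ₗ[k] H ⊗[k] H →ₗ[k] H ⊗[k] H :=
  TensorProduct.curry
    ((TensorProduct.map (TensorProduct.lift mul) (TensorProduct.lift mul)).comp
      (TensorProduct.tensorTensorTensorComm k H H H H).toLinearMap)

/-- The common setup: a (not necessarily associative) unital algebra `H` with a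
(not necessarily coassociative) counital coalgebra structure, such that the coproduct
and the counit are multiplicative and unital. -/
structure BialgQ (k : Type*) [Field k] (H : Type*) [AddCommGroup H] [Module k H] where
  /-- the (bilinear, not necessarily associative) multiplication -/
  mul : H →ₗ[k] H →ₗ[k] H
  /-- the unit element -/
  one : H
  /-- the (not necessarily coassociative) comultiplication -/
  comul : H →ₗ[k] H ⊗[k] H
  /-- the counit -/
  counit : H →ₗ[k] k
  one_mul : ∀ h, mul one h = h
  mul_one : ∀ h, mul h one = h
  /-- counit law `(ε ⊗ id) ∘ Δ = id` -/
  counit_comul : ∀ h,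
    TensorProduct.lid k H (TensorProduct.map counit LinearMap.id (comul h)) = h
  /-- counit law `(id ⊗ ε) ∘ Δ = id` -/
  comul_counit : ∀ h,
    TensorProduct.rid k H (TensorProduct.map LinearMap.id counit (comul h)) = h
  /-- `Δ` is multiplicative -/
  comul_mul : ∀ g h, comul (mul g h) = tmul2 k H mul (comul g) (comul h)
  /-- `Δ` is unital -/
  comul_one : comul one = one ⊗ₜ[k] one
  /-- `ε` is multiplicative -/
  counit_mul : ∀ g h, counit (mul g h) = counit g * counit h
  /-- `ε` is unital -/
  counit_one : counit one = 1

namespace BialgQ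

variable {k : Type*} [Field k] {H : Type*} [AddCommGroup H] [Module k H] (D : BialgQ k H)

/-- The multiplication as a linear map on the tensor product. -/
def mulMap : H ⊗[k] H →ₗ[k] H := TensorProduct.lift D.mul

/-- The right Galois map `β : g ⊗ h ↦ g h₍₁₎ ⊗ h₍₂₎`. -/
def rGalois : H ⊗[k] H →ₗ[k] H ⊗[k] H :=
  (TensorProduct.map D.mulMap LinearMap.id).comp
    (((TensorProduct.assoc k H H H).symm.toLinearMap).comp
      (TensorProduct.map LinearMap.id D.comul))

/-- The left Galois map `γ : g ⊗ h ↦ g₍₁₎ ⊗ g₍₂₎ h`. -/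
def lGalois : H ⊗[k] H →ₗ[k] H ⊗[k] H :=
  (TensorProduct.map LinearMap.id D.mulMap).comp
    (((TensorProduct.assoc k H H H).toLinearMap).comp
      (TensorProduct.map D.comul LinearMap.id))

/-- `φ` is almost left `H`-linear: `φ(g ⊗ h) = (g ⊗ 1) · φ(1 ⊗ h)`. -/
def AlmostLeftLinear (φ : H ⊗[k] H →ₗ[k] H ⊗[k] H) : Prop :=
  ∀ g h : H, φ (g ⊗ₜ[k] h) = tmul2 k H D.mul (g ⊗ₜ[k] D.one) (φ (D.one ⊗ₜ[k] h))

/-- `φ` is almost right `H`-linear: `φ(g ⊗ h) = φ(g ⊗ 1) · (1 ⊗ h)`. -/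
def AlmostRightLinear (φ : H ⊗[k] H →ₗ[k] H ⊗[k] H) : Prop :=
  ∀ g h : H, φ (g ⊗ₜ[k] h) = tmul2 k H D.mul (φ (g ⊗ₜ[k] D.one)) (D.one ⊗ₜ[k] h)

/-- `φ` is almost right `H`-colinear: `φ(g ⊗ h) = (id ⊗ ε)(φ(g ⊗ h₍₁₎)) ⊗ h₍₂₎`. -/
def AlmostRightColinear (φ : H ⊗[k] H →ₗ[k] H ⊗[k] H) : Prop :=
  ∀ g h : H, φ (g ⊗ₜ[k] h) =
    TensorProduct.map
      ((TensorProduct.rid k H).toLinearMap.comp (TensorProduct.map LinearMap.id D.counit))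
      LinearMap.id
      (TensorProduct.map φ LinearMap.id
        ((TensorProduct.assoc k H H H).symm (g ⊗ₜ[k] D.comul h)))

/-- `φ` is almost left `H`-colinear: `φ(g ⊗ h) = g₍₁₎ ⊗ (ε ⊗ id)(φ(g₍₂₎ ⊗ h))`. -/
def AlmostLeftColinear (φ : H ⊗[k] H →ₗ[k] H ⊗[k] H) : Prop :=
  ∀ g h : H, φ (g ⊗ₜ[k] h) =
    TensorProduct.map LinearMap.id
      ((TensorProduct.lid k H).toLinearMap.comp (TensorProduct.map D.counit LinearMap.id))
      (TensorProduct.map LinearMap.id φ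
        ((TensorProduct.assoc k H H H) (D.comul g ⊗ₜ[k] h)))

/-- The candidate inverse `g ⊗ h ↦ g S(h₍₁₎) ⊗ h₍₂₎` of the right Galois map, built
from a linear map `S : H → H`. -/
def betaInvOf (S : H →ₗ[k] H) : H ⊗[k] H →ₗ[k] H ⊗[k] H :=
  (TensorProduct.map (D.mulMap.comp (TensorProduct.map LinearMap.id S)) LinearMap.id).comp
    (((TensorProduct.assoc k H H H).symm.toLinearMap).comp
      (TensorProduct.map LinearMap.id D.comul))

/-- The candidate inverse `g ⊗ h ↦ g₍₁₎ ⊗ (S g₍₂₎) h` of the left Galois map, built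
from a linear map `S : H → H`. -/
def gammaInvOf (S : H →ₗ[k] H) : H ⊗[k] H →ₗ[k] H ⊗[k] H :=
  (TensorProduct.map LinearMap.id (D.mulMap.comp (TensorProduct.map S LinearMap.id))).comp
    (((TensorProduct.assoc k H H H).toLinearMap).comp
      (TensorProduct.map D.comul LinearMap.id))

/-- The antipode produced from an inverse `φ` of the right Galois map:
`S h = (id ⊗ ε)(φ(1 ⊗ h))`. -/
def antipodeOf (φ : H ⊗[k] H →ₗ[k] H ⊗[k] H) : H →ₗ[k] H :=
  ((TensorProduct.rid k H).toLinearMap.comp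
    ((TensorProduct.map LinearMap.id D.counit).comp
      (φ.comp (TensorProduct.mk k H H D.one))))

end BialgQ

/-- A Hopf quasigroup. -/
structure HopfQuasigroup (k : Type*) [Field k] (H : Type*) [AddCommGroup H] [Module k H]
    extends BialgQ k H where
  /-- `Δ` is coassociative -/
  coassoc : ∀ h, TensorProduct.assoc k H H H
      (TensorProduct.map comul LinearMap.id (comul h)) =
    TensorProduct.map LinearMap.id comul (comul h)
  /-- the antipode -/
  S : H →ₗ[k] H
  /-- `(S h₍₁₎)(h₍₂₎ g) = ε(h) g` -/
  antipode₁ : ∀ h g, TensorProduct.lift mul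
      (TensorProduct.map S (TensorProduct.lift mul)
        (TensorProduct.assoc k H H H (comul h ⊗ₜ[k] g))) = counit h • g
  /-- `h₍₁₎((S h₍₂₎) g) = ε(h) g` -/
  antipode₂ : ∀ h g, TensorProduct.lift mul
      (TensorProduct.map LinearMap.id
        ((TensorProduct.lift mul).comp (TensorProduct.map S LinearMap.id))
        (TensorProduct.assoc k H H H (comul h ⊗ₜ[k] g))) = counit h • g
  /-- `(g h₍₁₎) S h₍₂₎ = ε(h) g` -/
  antipode₃ : ∀ g h, TensorProduct.lift mul
      (TensorProduct.map (TensorProduct.lift mul) S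
        ((TensorProduct.assoc k H H H).symm (g ⊗ₜ[k] comul h))) = counit h • g
  /-- `(g S h₍₁₎) h₍₂₎ = ε(h) g` -/
  antipode₄ : ∀ g h, TensorProduct.lift mul
      (TensorProduct.map ((TensorProduct.lift mul).comp (TensorProduct.map LinearMap.id S))
        LinearMap.id
        ((TensorProduct.assoc k H H H).symm (g ⊗ₜ[k] comul h))) = counit h • g

/-- A Hopf coquasigroup. -/
structure HopfCoquasigroup (k : Type*) [Field k] (H : Type*) [AddCommGroup H] [Module k H]
    extends BialgQ k H where
  /-- the multiplication is associative -/
  mul_assoc : ∀ g h l, mul (mul g h) l = mul g (mul h l)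
  /-- the antipode -/
  S : H →ₗ[k] H
  /-- `(S h₍₁₎) h₍₂₎₍₁₎ ⊗ h₍₂₎₍₂₎ = 1 ⊗ h` -/
  coantipode₁ : ∀ h,
    TensorProduct.map ((TensorProduct.lift mul).comp (TensorProduct.map S LinearMap.id))
      LinearMap.id
      ((TensorProduct.assoc k H H H).symm
        (TensorProduct.map LinearMap.id comul (comul h))) = one ⊗ₜ[k] h
  /-- `h₍₁₎ S(h₍₂₎₍₁₎) ⊗ h₍₂₎₍₂₎ = 1 ⊗ h` -/
  coantipode₂ : ∀ h,
    TensorProduct.map ((TensorProduct.lift mul).comp (TensorProduct.map LinearMap.id S))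
      LinearMap.id
      ((TensorProduct.assoc k H H H).symm
        (TensorProduct.map LinearMap.id comul (comul h))) = one ⊗ₜ[k] h
  /-- `h₍₁₎₍₁₎ ⊗ h₍₁₎₍₂₎ S h₍₂₎ = h ⊗ 1` -/
  coantipode₃ : ∀ h,
    TensorProduct.map LinearMap.id
      ((TensorProduct.lift mul).comp (TensorProduct.map LinearMap.id S))
      (TensorProduct.assoc k H H H
        (TensorProduct.map comul LinearMap.id (comul h))) = h ⊗ₜ[k] one
  /-- `h₍₁₎₍₁₎ ⊗ (S h₍₁₎₍₂₎) h₍₂₎ = h ⊗ 1` -/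
  coantipode₄ : ∀ h,
    TensorProduct.map LinearMap.id
      ((TensorProduct.lift mul).comp (TensorProduct.map S LinearMap.id))
      (TensorProduct.assoc k H H H
        (TensorProduct.map comul LinearMap.id (comul h))) = h ⊗ₜ[k] one

namespace HopfQuasigroup

variable {k : Type*} [Field k] {H : Type*} [AddCommGroup H] [Module k H]
  (Q : HopfQuasigroup k H)

/-- `M` is a right `H`-Hopf module over the Hopf quasigroup `Q`, with (bilinear, unital)
action `act` and (coassociative, counital) coaction `ρ`, satisfying
`(m·h₍₁₎)·Sh₍₂₎ = ε(h) m = (m·Sh₍₁₎)·h₍₂₎` and `ρ(m·h) = m₍₀₎·h₍₁₎ ⊗ m₍₁₎h₍₂₎`. -/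
def IsHopfModule {M : Type*} [AddCommGroup M] [Module k M]
    (act : M ⊗[k] H →ₗ[k] M) (ρ : M →ₗ[k] M ⊗[k] H) : Prop :=
  (∀ m, act (m ⊗ₜ[k] Q.one) = m) ∧
  (∀ m, TensorProduct.assoc k M H H (TensorProduct.map ρ LinearMap.id (ρ m)) =
      TensorProduct.map LinearMap.id Q.comul (ρ m)) ∧
  (∀ m, TensorProduct.rid k M (TensorProduct.map LinearMap.id Q.counit (ρ m)) = m) ∧
  (∀ m h, act (TensorProduct.map act Q.S
      ((TensorProduct.assoc k M H H).symm (m ⊗ₜ[k] Q.comul h))) = Q.counit h • m) ∧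
  (∀ m h, act (TensorProduct.map (act.comp (TensorProduct.map LinearMap.id Q.S)) LinearMap.id
      ((TensorProduct.assoc k M H H).symm (m ⊗ₜ[k] Q.comul h))) = Q.counit h • m) ∧
  (∀ m h, ρ (act (m ⊗ₜ[k] h)) =
      TensorProduct.map act (TensorProduct.lift Q.mul)
        (TensorProduct.tensorTensorTensorComm k M H H H (ρ m ⊗ₜ[k] Q.comul h)))

/-- `m ↦ (m₍₀₎ · S m₍₁₎) ⊗ m₍₂₎`. -/
def coinvPart {M : Type*} [AddCommGroup M] [Module k M]
    (act : M ⊗[k] H →ₗ[k] M) (ρ : M →ₗ[k] M ⊗[k] H) : M →ₗ[k] M ⊗[k] H :=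
  (TensorProduct.map (act.comp (TensorProduct.map LinearMap.id Q.S)) LinearMap.id).comp
    ((TensorProduct.map ρ LinearMap.id).comp ρ)

/-- The induced action `m ⊳ h = (m₍₀₎ · S m₍₁₎) · (m₍₂₎ h)` of a right Hopf module. -/
def inducedAct {M : Type*} [AddCommGroup M] [Module k M]
    (act : M ⊗[k] H →ₗ[k] M) (ρ : M →ₗ[k] M ⊗[k] H) : M ⊗[k] H →ₗ[k] M :=
  act.comp ((TensorProduct.map LinearMap.id (TensorProduct.lift Q.mul)).comp
    (((TensorProduct.assoc k M H H).toLinearMap).comp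
      (TensorProduct.map (Q.coinvPart act ρ) LinearMap.id)))

/-- The free action `(m ⊗ h) · g = m ⊗ h g` on `M ⊗ H`. -/
def freeAct (M : Type*) [AddCommGroup M] [Module k M] :
    (M ⊗[k] H) ⊗[k] H →ₗ[k] M ⊗[k] H :=
  (TensorProduct.map LinearMap.id (TensorProduct.lift Q.mul)).comp
    (TensorProduct.assoc k M H H).toLinearMap

/-- The coaction `id ⊗ Δ : m ⊗ h ↦ m ⊗ h₍₁₎ ⊗ h₍₂₎` on `M ⊗ H`. -/
def freeCoact (M : Type*) [AddCommGroup M] [Module k M] :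
    M ⊗[k] H →ₗ[k] (M ⊗[k] H) ⊗[k] H :=
  ((TensorProduct.assoc k M H H).symm.toLinearMap).comp
    (TensorProduct.map LinearMap.id Q.comul)

/-- The diagonal action `(m ⊗ h) · g = m · g₍₁₎ ⊗ h g₍₂₎` on `M ⊗ H`. -/
def diagAct {M : Type*} [AddCommGroup M] [Module k M]
    (act : M ⊗[k] H →ₗ[k] M) : (M ⊗[k] H) ⊗[k] H →ₗ[k] M ⊗[k] H :=
  (TensorProduct.map act (TensorProduct.lift Q.mul)).comp
    (((TensorProduct.tensorTensorTensorComm k M H H H).toLinearMap).comp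
      (TensorProduct.map LinearMap.id Q.comul))

/-- The coinvariants `M^{coH} = {m | ρ(m) = m ⊗ 1}` of a right `H`-comodule. -/
def coinvariants {M : Type*} [AddCommGroup M] [Module k M]
    (ρ : M →ₗ[k] M ⊗[k] H) : Submodule k M :=
  LinearMap.ker (ρ - (TensorProduct.mk k M H).flip Q.one)

end HopfQuasigroup

namespace HopfCoquasigroup

variable {k : Type*} [Field k] {H : Type*} [AddCommGroup H] [Module k H]
  (Q : HopfCoquasigroup k H)

/-- `M` is a right `H`-Hopf module over the Hopf coquasigroup `Q`, with (bilinear,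
associative, unital) action `act` and (counital, not necessarily coassociative)
coaction `ρ`, satisfying `m₍₀₎₍₀₎ ⊗ m₍₀₎₍₁₎ S m₍₁₎ = m ⊗ 1 = m₍₀₎₍₀₎ ⊗ (S m₍₀₎₍₁₎) m₍₁₎`
and `ρ(m·h) = m₍₀₎·h₍₁₎ ⊗ m₍₁₎h₍₂₎`. -/
def IsHopfModule {M : Type*} [AddCommGroup M] [Module k M]
    (act : M ⊗[k] H →ₗ[k] M) (ρ : M →ₗ[k] M ⊗[k] H) : Prop :=
  (∀ m, act (m ⊗ₜ[k] Q.one) = m) ∧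
  (∀ m g h, act (act (m ⊗ₜ[k] g) ⊗ₜ[k] h) = act (m ⊗ₜ[k] Q.mul g h)) ∧
  (∀ m, TensorProduct.rid k M (TensorProduct.map LinearMap.id Q.counit (ρ m)) = m) ∧
  (∀ m, TensorProduct.map LinearMap.id
      ((TensorProduct.lift Q.mul).comp (TensorProduct.map LinearMap.id Q.S))
      (TensorProduct.assoc k M H H (TensorProduct.map ρ LinearMap.id (ρ m)))
      = m ⊗ₜ[k] Q.one) ∧
  (∀ m, TensorProduct.map LinearMap.id
      ((TensorProduct.lift Q.mul).comp (TensorProduct.map Q.S LinearMap.id))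
      (TensorProduct.assoc k M H H (TensorProduct.map ρ LinearMap.id (ρ m)))
      = m ⊗ₜ[k] Q.one) ∧
  (∀ m h, ρ (act (m ⊗ₜ[k] h)) =
      TensorProduct.map act (TensorProduct.lift Q.mul)
        (TensorProduct.tensorTensorTensorComm k M H H H (ρ m ⊗ₜ[k] Q.comul h)))

/-- The induced coaction `λ(m) = ((m₍₀₎₍₀₎ · S m₍₀₎₍₁₎) · m₍₁₎₍₁₎) ⊗ m₍₁₎₍₂₎`. -/
def inducedCoact {M : Type*} [AddCommGroup M] [Module k M]
    (act : M ⊗[k] H →ₗ[k] M) (ρ : M →ₗ[k] M ⊗[k] H) : M →ₗ[k] M ⊗[k] H :=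
  (TensorProduct.map act LinearMap.id).comp
    (((TensorProduct.assoc k M H H).symm.toLinearMap).comp
      ((TensorProduct.map (act.comp (TensorProduct.map LinearMap.id Q.S)) LinearMap.id).comp
        ((TensorProduct.map ρ Q.comul).comp ρ)))

end HopfCoquasigroup

namespace HopfQuasigroup

section InducedAction

variable {k : Type*} [Field k] {H : Type*} [AddCommGroup H] [Module k H]
  (Q : HopfQuasigroup k H) {M : Type*} [AddCommGroup M] [Module k M]

/-- `h₍₁₎ S h₍₂₎ = ε(h) 1`. -/
lemma mul_antipode (h : H) :
    TensorProduct.lift Q.mul (TensorProduct.map LinearMap.id Q.S (Q.comul h)) =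
      Q.counit h • Q.one := by
  rw [← Q.antipode₃ Q.one h]
  induction Q.comul h using TensorProduct.induction_on with
  | zero => simp
  | tmul x y => simp [Q.one_mul]
  | add x y hx hy => simp only [map_add, tmul_add, hx, hy]

lemma antipode_one : Q.S Q.one = Q.one := by
  have h := Q.antipode₁ Q.one Q.one
  simpa [Q.comul_one, Q.mul_one, Q.counit_one] using h

/-- For a comodule `(N, δ)` and maps with `K(h₍₁₎ ⊗ h₍₂₎) = ε(h) y`, one has
`L(n₍₀₎ ⊗ n₍₃₎) ⊗ K(n₍₁₎ ⊗ n₍₂₎) = L(n₍₀₎ ⊗ n₍₁₎) ⊗ y`. -/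
lemma map_outer_inner {N X Y : Type*} [AddCommGroup N] [Module k N]
    [AddCommGroup X] [Module k X] [AddCommGroup Y] [Module k Y] (δ : N →ₗ[k] N ⊗[k] H)
    (coassoc : ∀ n, TensorProduct.assoc k N H H (TensorProduct.map δ LinearMap.id (δ n)) =
      TensorProduct.map LinearMap.id Q.comul (δ n))
    (counital : ∀ n, TensorProduct.rid k N (TensorProduct.map LinearMap.id Q.counit (δ n)) = n)
    (L : N ⊗[k] H →ₗ[k] X) (K : H ⊗[k] H →ₗ[k] Y) (y : Y)
    (hK : ∀ h, K (Q.comul h) = Q.counit h • y) (n : N) :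
    TensorProduct.map L K (TensorProduct.tensorTensorTensorComm k N H H H
      (TensorProduct.map δ ((TensorProduct.comm k H H).toLinearMap.comp Q.comul) (δ n))) =
      L (δ n) ⊗ₜ[k] y := by
  -- `Θ((n ⊗ h) ⊗ (g ⊗ l)) = L(n ⊗ l) ⊗ K(h ⊗ g)`
  let Θ : (N ⊗[k] H) ⊗[k] (H ⊗[k] H) →ₗ[k] X ⊗[k] Y :=
    (TensorProduct.map L K).comp
      ((TensorProduct.tensorTensorTensorComm k N H H H).toLinearMap.comp
        (TensorProduct.map LinearMap.id (TensorProduct.comm k H H).toLinearMap))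
  have split (t : N ⊗[k] H) : TensorProduct.map L K
      (TensorProduct.tensorTensorTensorComm k N H H H
        (TensorProduct.map δ ((TensorProduct.comm k H H).toLinearMap.comp Q.comul) t)) =
      Θ (TensorProduct.map δ LinearMap.id (TensorProduct.map LinearMap.id Q.comul t)) := by
    induction t using TensorProduct.induction_on with
    | zero => simp
    | tmul a b => simp [Θ]
    | add s t hs ht => simp only [map_add, hs, ht]
  have regroup (s : N ⊗[k] H) (b : H) :
      Θ (TensorProduct.map δ LinearMap.id (TensorProduct.assoc k N H H (s ⊗ₜ[k] b))) =
      Θ ((TensorProduct.assoc k (N ⊗[k] H) H H)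
        (TensorProduct.map δ LinearMap.id s ⊗ₜ[k] b)) := by
    induction s using TensorProduct.induction_on with
    | zero => simp
    | tmul a c => simp
    | add s t hs ht => simp only [map_add, add_tmul, hs, ht]
  have inner (c : N) (u : H ⊗[k] H) (b : H) :
      Θ ((TensorProduct.assoc k (N ⊗[k] H) H H)
        ((TensorProduct.assoc k N H H).symm (c ⊗ₜ[k] u) ⊗ₜ[k] b)) =
      L (c ⊗ₜ[k] b) ⊗ₜ[k] K u := by
    induction u using TensorProduct.induction_on with
    | zero => simp
    | tmul x z => simp [Θ]
    | add s t hs ht => simp only [map_add, add_tmul, tmul_add, hs, ht]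
  have contract (s : N ⊗[k] H) (b : H) :
      Θ ((TensorProduct.assoc k (N ⊗[k] H) H H)
        ((TensorProduct.assoc k N H H).symm
          (TensorProduct.map LinearMap.id Q.comul s) ⊗ₜ[k] b)) =
      L (TensorProduct.rid k N (TensorProduct.map LinearMap.id Q.counit s) ⊗ₜ[k] b)
        ⊗ₜ[k] y := by
    induction s using TensorProduct.induction_on with
    | zero => simp
    | tmul c d =>
      rw [TensorProduct.map_tmul, LinearMap.id_apply, inner, hK]
      simp [← TensorProduct.smul_tmul']
    | add s t hs ht => simp only [map_add, add_tmul, hs, ht]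
  rw [split, ← coassoc]
  induction δ n using TensorProduct.induction_on with
  | zero => simp
  | tmul a b =>
    rw [TensorProduct.map_tmul, LinearMap.id_apply, regroup,
      ← (TensorProduct.assoc k N H H).symm_apply_apply (TensorProduct.map δ _ (δ a)),
      coassoc, contract, counital]
  | add s t hs ht => simp only [map_add, add_tmul, hs, ht]

/-- The coinvariant projection `m ↦ m₍₀₎ · S m₍₁₎`. -/
def coinvProj (act : M ⊗[k] H →ₗ[k] M) (ρ : M →ₗ[k] M ⊗[k] H) : M →ₗ[k] M :=
  (act.comp (TensorProduct.map LinearMap.id Q.S)).comp ρ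

lemma coinvPart_apply (act : M ⊗[k] H →ₗ[k] M) (ρ : M →ₗ[k] M ⊗[k] H) (m : M) :
    Q.coinvPart act ρ m = TensorProduct.map (Q.coinvProj act ρ) LinearMap.id (ρ m) := by
  simp only [coinvPart, LinearMap.comp_apply]
  induction ρ m using TensorProduct.induction_on with
  | zero => simp
  | tmul a b => simp [coinvProj]
  | add s t hs ht => simp only [map_add, hs, ht]

lemma inducedAct_tmul (act : M ⊗[k] H →ₗ[k] M) (ρ : M →ₗ[k] M ⊗[k] H) (m : M) (h : H) :
    Q.inducedAct act ρ (m ⊗ₜ[k] h) =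
      act (TensorProduct.map (Q.coinvProj act ρ) (TensorProduct.lift Q.mul)
        (TensorProduct.assoc k M H H (ρ m ⊗ₜ[k] h))) := by
  simp only [inducedAct, LinearMap.comp_apply, TensorProduct.map_tmul, coinvPart_apply,
    LinearMap.id_apply, LinearEquiv.coe_coe]
  induction ρ m using TensorProduct.induction_on with
  | zero => simp
  | tmul a b => simp
  | add s t hs ht => simp only [map_add, add_tmul, hs, ht]

/-- The product `(m ⊗ g)(h ⊗ l) = m · h ⊗ g l` of `M ⊗ H` with `H ⊗ H`. -/
def tensorAct (act : M ⊗[k] H →ₗ[k] M) : (M ⊗[k] H) ⊗[k] (H ⊗[k] H) →ₗ[k] M ⊗[k] H :=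
  (TensorProduct.map act (TensorProduct.lift Q.mul)).comp
    (TensorProduct.tensorTensorTensorComm k M H H H).toLinearMap

/-- The map `h ↦ S h₍₂₎ ⊗ S h₍₁₎`. -/
def antipodeSwap : H →ₗ[k] H ⊗[k] H :=
  (TensorProduct.map Q.S Q.S).comp ((TensorProduct.comm k H H).toLinearMap.comp Q.comul)

namespace IsHopfModule

variable {Q} {act : M ⊗[k] H →ₗ[k] M} {ρ : M →ₗ[k] M ⊗[k] H}

/-- `(m₍₀₎ · S m₍₁₎) · m₍₂₎ = m`. -/
lemma act_coinvPart (hM : Q.IsHopfModule act ρ) (m : M) :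
    act (TensorProduct.map (Q.coinvProj act ρ) LinearMap.id (ρ m)) = m := by
  obtain ⟨-, coassoc, counital, -, cancel, -⟩ := hM
  have key (t : M ⊗[k] H) :
      act (TensorProduct.map (act.comp (TensorProduct.map LinearMap.id Q.S)) LinearMap.id
        ((TensorProduct.assoc k M H H).symm (TensorProduct.map LinearMap.id Q.comul t))) =
      TensorProduct.rid k M (TensorProduct.map LinearMap.id Q.counit t) := by
    induction t using TensorProduct.induction_on with
    | zero => simp
    | tmul a b => rw [TensorProduct.map_tmul, LinearMap.id_apply, cancel]; simp
    | add s t hs ht => simp only [map_add, hs, ht]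
  rw [← coinvPart_apply]
  conv_rhs => rw [← counital m, ← key, ← coassoc, LinearEquiv.symm_apply_apply]
  rfl

/-- The induced action has the same coinvariant projection as the original one. -/
lemma coinvProj_inducedAct (hM : Q.IsHopfModule act ρ) :
    Q.coinvProj (Q.inducedAct act ρ) ρ = Q.coinvProj act ρ := by
  obtain ⟨unit, coassoc, counital, -, -, -⟩ := hM
  have expand (t : M ⊗[k] H) :
      Q.inducedAct act ρ (TensorProduct.map LinearMap.id Q.S t) =
      act (TensorProduct.map (Q.coinvProj act ρ)
        ((TensorProduct.lift Q.mul).comp (TensorProduct.map LinearMap.id Q.S))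
        (TensorProduct.assoc k M H H (TensorProduct.map ρ LinearMap.id t))) := by
    induction t using TensorProduct.induction_on with
    | zero => simp
    | tmul a b =>
      simp only [TensorProduct.map_tmul, LinearMap.id_apply, inducedAct_tmul]
      induction ρ a using TensorProduct.induction_on with
      | zero => simp
      | tmul c d => simp
      | add s t hs ht => simp only [map_add, add_tmul, hs, ht]
    | add s t hs ht => simp only [map_add, hs, ht]
  have contract (t : M ⊗[k] H) :
      act (TensorProduct.map (Q.coinvProj act ρ)
        ((TensorProduct.lift Q.mul).comp (TensorProduct.map LinearMap.id Q.S))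
        (TensorProduct.map LinearMap.id Q.comul t)) =
      Q.coinvProj act ρ
        (TensorProduct.rid k M (TensorProduct.map LinearMap.id Q.counit t)) := by
    induction t using TensorProduct.induction_on with
    | zero => simp
    | tmul a b => simp [Q.mul_antipode, unit]
    | add s t hs ht => simp only [map_add, hs, ht]
  ext m
  conv_lhs => rw [coinvProj, LinearMap.comp_apply, LinearMap.comp_apply, expand, coassoc,
    contract, counital]

/-- `((m ⊗ g) Δ(h₍₁₎)) (S h₍₃₎ ⊗ S h₍₂₎) = ε(h) (m ⊗ g)`. -/
lemma tensorAct_cancel (hM : Q.IsHopfModule act ρ) (n : M ⊗[k] H) (h : H) :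
    Q.tensorAct act (TensorProduct.map
      ((Q.tensorAct act).comp ((TensorProduct.mk k _ _ n).comp Q.comul))
      Q.antipodeSwap (Q.comul h)) = Q.counit h • n := by
  obtain ⟨-, -, -, cancel, -, -⟩ := hM
  induction n using TensorProduct.induction_on with
  | zero =>
    induction Q.comul h using TensorProduct.induction_on with
    | zero => simp
    | tmul x y => simp
    | add s t hs ht => simp_all only [map_add, smul_zero, add_zero]
  | tmul a b =>
    let L : H ⊗[k] H →ₗ[k] M :=
      act.comp (TensorProduct.map (act.comp (TensorProduct.mk k M H a)) Q.S)
    let K : H ⊗[k] H →ₗ[k] H :=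
      (TensorProduct.lift Q.mul).comp (TensorProduct.map (Q.mul b) Q.S)
    have hL : L (Q.comul h) = Q.counit h • a := by
      rw [← cancel]
      induction Q.comul h using TensorProduct.induction_on with
      | zero => simp
      | tmul x y => simp [L]
      | add s t hs ht => simp only [map_add, tmul_add, hs, ht]
    have hK (g : H) : K (Q.comul g) = Q.counit g • b := by
      rw [← Q.antipode₃]
      induction Q.comul g using TensorProduct.induction_on with
      | zero => simp
      | tmul x y => simp [K]
      | add s t hs ht => simp only [map_add, tmul_add, hs, ht]
    have outer := Q.map_outer_inner Q.comul Q.coassoc Q.comul_counit L K b hK h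
    rw [hL, ← TensorProduct.smul_tmul'] at outer
    rw [← outer]
    induction Q.comul h using TensorProduct.induction_on with
    | zero => simp
    | tmul x y =>
      simp only [TensorProduct.map_tmul, LinearMap.comp_apply, antipodeSwap]
      induction Q.comul y using TensorProduct.induction_on with
      | zero => simp
      | tmul u v =>
        induction Q.comul x using TensorProduct.induction_on with
        | zero => simp
        | tmul p q => simp [tensorAct, L, K]
        | add s t hs ht => simp only [map_add, add_tmul, hs, ht]
      | add s t hs ht => simp only [map_add, tmul_add, hs, ht]
    | add s t hs ht => simp only [map_add, hs, ht]
  | add s t hs ht =>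
    rw [smul_add, ← hs, ← ht]
    simp only [map_add, LinearMap.add_comp, LinearMap.comp_add, TensorProduct.map_add_left,
      LinearMap.add_apply]

/-- `m₍₀₎ · S m₍₁₎` is coinvariant. -/
lemma coaction_coinvProj (hM : Q.IsHopfModule act ρ) (m : M) :
    ρ (Q.coinvProj act ρ m) = Q.coinvProj act ρ m ⊗ₜ[k] Q.one := by
  have ⟨_, coassoc, counital, _, _, compat⟩ := hM
  -- `T(n ⊗ (h ⊗ g)) = ρ(n · h) (S g₍₂₎ ⊗ S g₍₁₎)`
  let T : M ⊗[k] (H ⊗[k] H) →ₗ[k] M ⊗[k] H :=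
    (Q.tensorAct act).comp ((TensorProduct.map (ρ.comp act) Q.antipodeSwap).comp
      (TensorProduct.assoc k M H H).symm.toLinearMap)
  have cancel (a : M) (b : H) : T (a ⊗ₜ[k] Q.comul b) = Q.counit b • ρ a := by
    rw [← hM.tensorAct_cancel]
    induction Q.comul b using TensorProduct.induction_on with
    | zero => simp
    | tmul x y => simp [T, tensorAct, compat]
    | add s t hs ht => simp only [map_add, tmul_add, hs, ht]
  have collapse (t : M ⊗[k] H) :
      T (TensorProduct.map (Q.coinvProj act ρ) Q.comul t) =
      ρ (Q.coinvProj act ρ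
        (TensorProduct.rid k M (TensorProduct.map LinearMap.id Q.counit t))) := by
    induction t using TensorProduct.induction_on with
    | zero => simp
    | tmul a b => simp [cancel]
    | add s t hs ht => simp only [map_add, hs, ht]
  have absorb (t : M ⊗[k] H) :
      T (TensorProduct.map (Q.coinvProj act ρ) LinearMap.id
        (TensorProduct.assoc k M H H (TensorProduct.map ρ LinearMap.id t))) =
      Q.tensorAct act (TensorProduct.map ρ Q.antipodeSwap t) := by
    induction t using TensorProduct.induction_on with
    | zero => simp
    | tmul a b =>
      conv_rhs => rw [TensorProduct.map_tmul, ← hM.act_coinvPart a]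
      rw [TensorProduct.map_tmul]
      induction ρ a using TensorProduct.induction_on with
      | zero => simp
      | tmul c d => simp [T]
      | add s t hs ht => simp only [map_add, add_tmul, hs, ht]
    | add s t hs ht => simp only [map_add, hs, ht]
  have start : ρ (Q.coinvProj act ρ m) =
      Q.tensorAct act (TensorProduct.map ρ Q.antipodeSwap (ρ m)) := by
    rw [← absorb, coassoc, ← LinearMap.comp_apply (TensorProduct.map _ _),
      ← TensorProduct.map_comp, LinearMap.comp_id, LinearMap.id_comp, collapse, counital]
  have outer := Q.map_outer_inner ρ coassoc counital
    (act.comp (TensorProduct.map LinearMap.id Q.S))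
    ((TensorProduct.lift Q.mul).comp (TensorProduct.map LinearMap.id Q.S)) Q.one
    Q.mul_antipode m
  rw [start]
  refine Eq.trans ?_ outer
  induction ρ m using TensorProduct.induction_on with
  | zero => simp
  | tmul a b =>
    simp only [TensorProduct.map_tmul, LinearMap.comp_apply, antipodeSwap]
    induction ρ a using TensorProduct.induction_on with
    | zero => simp
    | tmul c d =>
      induction Q.comul b using TensorProduct.induction_on with
      | zero => simp
      | tmul u v => simp [tensorAct]
      | add s t hs ht => simp only [map_add, tmul_add, hs, ht]
    | add s t hs ht => simp only [map_add, add_tmul, hs, ht]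
  | add s t hs ht => simp only [map_add, hs, ht]

lemma coinvProj_coinvProj (hM : Q.IsHopfModule act ρ) (m : M) :
    Q.coinvProj act ρ (Q.coinvProj act ρ m) = Q.coinvProj act ρ m := by
  conv_lhs => rw [coinvProj, LinearMap.comp_apply, ← coinvProj, hM.coaction_coinvProj]
  simp [Q.antipode_one, hM.1]

/-- On coinvariants `m₍₀₎ · S m₍₁₎` the induced action is the original one. -/
lemma inducedAct_coinvProj (hM : Q.IsHopfModule act ρ) (m : M) (h : H) :
    Q.inducedAct act ρ (Q.coinvProj act ρ m ⊗ₜ[k] h) = act (Q.coinvProj act ρ m ⊗ₜ[k] h) := by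
  rw [inducedAct_tmul, hM.coaction_coinvProj]
  simp [hM.coinvProj_coinvProj, Q.one_mul]

end IsHopfModule

end InducedAction

end HopfQuasigroup

/-- (a) the induced action of the induced action coincides with the induced
action; (b) if the original action is associative then the induced action coincides with the
original action. -/
theorem stmt10 {k : Type*} [Field k] {H : Type*} [AddCommGroup H] [Module k H]
    (Q : HopfQuasigroup k H) {M : Type*} [AddCommGroup M] [Module k M]
    (act : M ⊗[k] H →ₗ[k] M) (ρ : M →ₗ[k] M ⊗[k] H)
    (hM : Q.IsHopfModule act ρ) :
    (∀ (m : M) (h : H), Q.inducedAct (Q.inducedAct act ρ) ρ (m ⊗ₜ[k] h) =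
        Q.inducedAct act ρ (m ⊗ₜ[k] h)) ∧
    ((∀ (m : M) (g h : H), act (act (m ⊗ₜ[k] g) ⊗ₜ[k] h) = act (m ⊗ₜ[k] Q.mul g h)) →
      ∀ (m : M) (h : H), Q.inducedAct act ρ (m ⊗ₜ[k] h) = act (m ⊗ₜ[k] h)) := by
  refine ⟨fun m h => ?_, fun hassoc m h => ?_⟩
  · rw [HopfQuasigroup.inducedAct_tmul, hM.coinvProj_inducedAct,
      HopfQuasigroup.inducedAct_tmul]
    induction ρ m using TensorProduct.induction_on with
    | zero => simp
    | tmul a b => simp [hM.inducedAct_coinvProj]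
    | add s t hs ht => simp only [map_add, add_tmul, hs, ht]
  · conv_rhs => rw [← hM.act_coinvPart m]
    rw [HopfQuasigroup.inducedAct_tmul]
    induction ρ m using TensorProduct.induction_on with
    | zero => simp
    | tmul a b => simp [hassoc]
    | add s t hs ht => simp only [map_add, add_tmul, hs, ht]
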